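/- arXiv:math/9908067 — 2 statements merged into one kernel-verified Lean document; each statement's English description precedes it below -/
import Mathlib

section
/- For integers a ≥ 2 and b ≥ 2, the following decomposition holds: ζ(a,b) = (−1)^b [ Σ_{n=2}^{b} (−1)^n C(a+b−n−1, a−1) ζ(n)ζ(a+b−n) + Σ_{n=2}^{a} C(a+b−n−1, b−1) ζ(n, a+b−n) − C(a+b−2, a−1) (ζ(a+b) + ζ(a+b−1, 1)) ], where C(m,k) denotes the binomial coefficient. -/
noncomputable def zeta1 (k : ℕ) : ℝ := ∑' n : ℕ+, 1 / (n : ℝ) ^ k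

noncomputable def zeta2 (a b : ℕ) : ℝ :=
  ∑' p : {p : ℕ × ℕ // p.2 < p.1 ∧ 0 < p.2},
    1 / ((p.val.1 : ℝ) ^ a * (p.val.2 : ℝ) ^ b)

/-- The basic block of the partial fraction expansion. -/
noncomputable def pfW (a b : ℕ) (t v : ℝ) : ℝ :=
  ∑ j ∈ Finset.range (b + 1), ((a + j).choose a : ℝ) * t ^ (a + 1 + j) * v ^ (b + 1 - j)

lemma pfW_zero_right (a : ℕ) (t v : ℝ) : pfW a 0 t v = t ^ (a + 1) * v := by
  simp [pfW]

lemma pfW_zero_left (b : ℕ) (t v : ℝ) :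
    pfW 0 (b + 1) t v = t * v ^ (b + 2) + t * pfW 0 b t v := by
  unfold pfW
  rw [Finset.sum_range_succ', Finset.mul_sum, add_comm]
  congr 1
  · simp
  · refine Finset.sum_congr rfl fun j _ => ?_
    rw [show b + 1 + 1 - (j + 1) = b + 1 - j by omega]
    simp
    ring

lemma pfW_succ (a b : ℕ) (t v : ℝ) :
    pfW (a + 1) (b + 1) t v = t * (pfW a (b + 1) t v + pfW (a + 1) b t v) := by
  unfold pfW
  rw [Finset.sum_range_succ', Finset.sum_range_succ' _ (b + 1)]
  have h : ∀ j ∈ Finset.range (b + 1),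
      ((a + 1 + (j + 1)).choose (a + 1) : ℝ) * t ^ (a + 1 + 1 + (j + 1)) * v ^ (b + 1 + 1 - (j + 1))
      = t * (((a + (j + 1)).choose a : ℝ) * t ^ (a + 1 + (j + 1)) * v ^ (b + 1 + 1 - (j + 1)))
        + t * (((a + 1 + j).choose (a + 1) : ℝ) * t ^ (a + 1 + 1 + j) * v ^ (b + 1 - j)) := by
    intro j _
    rw [show b + 1 + 1 - (j + 1) = b + 1 - j by omega,
      show a + 1 + (j + 1) = (a + (j + 1)) + 1 by ring, Nat.choose_succ_succ,
      show a + (j + 1) = a + 1 + j by ring]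
    push_cast
    ring
  rw [Finset.sum_congr rfl h, Finset.sum_add_distrib, ← Finset.mul_sum, ← Finset.mul_sum]
  simp
  ring

lemma pf_identity (t u v : ℝ) (h : u * v = t * (u - v)) (a b : ℕ) :
    u ^ (b + 1) * v ^ (a + 1)
      = (-1) ^ (a + 1) * pfW a b (-t) u + (-1) ^ (b + 1) * pfW b a t v := by
  induction a generalizing b with
  | zero =>
    induction b with
    | zero => simp [pfW_zero_right]; linarith
    | succ b ih =>
      rw [pfW_zero_left, pfW_zero_right]
      rw [pfW_zero_right] at ih
      have : u ^ (b + 1 + 1) * v ^ (0 + 1) = t * u ^ (b + 2) - t * (u ^ (b + 1) * v ^ (0 + 1)) := by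
        linear_combination u ^ (b + 1) * h
      rw [this, ih]
      ring
  | succ a iha =>
    induction b with
    | zero =>
      have h2 := iha 0
      rw [pfW_zero_right] at h2 ⊢
      rw [pfW_zero_left]
      have : u ^ (0 + 1) * v ^ (a + 1 + 1) = t * (u ^ (0 + 1) * v ^ (a + 1)) - t * v ^ (a + 2) := by
        linear_combination v ^ (a + 1) * h
      rw [this, h2]
      ring
    | succ b ih =>
      have h2 := iha (b + 1)
      rw [pfW_succ, pfW_succ]
      have : u ^ (b + 1 + 1) * v ^ (a + 1 + 1)
          = t * (u ^ (b + 1 + 1) * v ^ (a + 1)) - t * (u ^ (b + 1) * v ^ (a + 1 + 1)) := by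
        linear_combination u ^ (b + 1) * v ^ (a + 1) * h
      rw [this, h2, ih]
      ring

/-- Pairs `x > d > 0` are `(y + d, d)`. -/
def pairEquiv : ℕ+ × ℕ+ ≃ {p : ℕ × ℕ // p.2 < p.1 ∧ 0 < p.2} where
  toFun q := ⟨((q.1 : ℕ) + q.2, q.2), by have := q.1.pos; simp, q.2.pos⟩
  invFun p := (⟨p.1.1 - p.1.2, Nat.sub_pos_of_lt p.2.1⟩, ⟨p.1.2, p.2.2⟩)
  left_inv q := by
    apply Prod.ext <;> apply PNat.eq <;> simp
  right_inv p := by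
    obtain ⟨⟨x, y⟩, h1, h2⟩ := p
    simp only at h1 h2
    ext <;> simp
    omega

lemma zeta2_pair (i j : ℕ) :
    zeta2 i j = ∑' q : ℕ+ × ℕ+, 1 / (((q.1 : ℝ) + q.2) ^ i * (q.2 : ℝ) ^ j) := by
  unfold zeta2
  rw [← pairEquiv.tsum_eq]
  simp [pairEquiv]

lemma zeta1_summable (i : ℕ) (hi : 2 ≤ i) : Summable fun n : ℕ+ => 1 / (n : ℝ) ^ i := by
  have := (Real.summable_one_div_nat_pow (p := i)).2 (by omega)
  exact this.comp_injective PNat.coe_injective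

lemma prod_summable (i j : ℕ) (hi : 2 ≤ i) (hj : 2 ≤ j) :
    Summable fun q : ℕ+ × ℕ+ => 1 / (q.1 : ℝ) ^ i * (1 / (q.2 : ℝ) ^ j) :=
  (zeta1_summable i hi).mul_of_nonneg (zeta1_summable j hj)
    (fun _ => by positivity) (fun _ => by positivity)

lemma prod_hasSum (i j : ℕ) (hi : 2 ≤ i) (hj : 2 ≤ j) :
    HasSum (fun q : ℕ+ × ℕ+ => 1 / (q.1 : ℝ) ^ i * (1 / (q.2 : ℝ) ^ j)) (zeta1 i * zeta1 j) :=
  (zeta1_summable i hi).hasSum.mul (zeta1_summable j hj).hasSum (prod_summable i j hi hj)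

lemma pnat_cast_pos (n : ℕ+) : (0 : ℝ) < n := by exact_mod_cast n.pos

lemma pnat_cast_one_le (n : ℕ+) : (1 : ℝ) ≤ n := by exact_mod_cast n.pos

lemma zeta2_hasSum (i j : ℕ) (hi : 2 ≤ i) (hj : 2 ≤ j) :
    HasSum (fun q : ℕ+ × ℕ+ => 1 / (((q.1 : ℝ) + q.2) ^ i * (q.2 : ℝ) ^ j)) (zeta2 i j) := by
  rw [zeta2_pair]
  refine Summable.hasSum ?_
  refine Summable.of_nonneg_of_le (fun q => ?_) (fun q => ?_) (prod_summable i j hi hj)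
  · have := pnat_cast_pos q.1; have := pnat_cast_pos q.2; positivity
  · have h1 := pnat_cast_pos q.1
    have h2 := pnat_cast_pos q.2
    rw [one_div_mul_one_div]
    gcongr
    linarith

lemma zeta2_hasSum_one (i : ℕ) (hi : 3 ≤ i) :
    HasSum (fun q : ℕ+ × ℕ+ => 1 / (((q.1 : ℝ) + q.2) ^ i * (q.2 : ℝ) ^ 1)) (zeta2 i 1) := by
  rw [zeta2_pair]
  refine Summable.hasSum ?_
  refine Summable.of_nonneg_of_le (fun q => ?_) (fun q => ?_) (prod_summable 2 2 le_rfl le_rfl)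
  · have := pnat_cast_pos q.1; have := pnat_cast_pos q.2; positivity
  · have h1 := pnat_cast_pos q.1
    have h2 := pnat_cast_pos q.2
    have h3 := pnat_cast_one_le q.1
    rw [one_div_mul_one_div]
    have h4 : ((q.1 : ℝ) + q.2) ^ 3 ≤ ((q.1 : ℝ) + q.2) ^ i :=
      pow_le_pow_right₀ (by linarith) hi
    have h5 : (q.1 : ℝ) ^ 2 * q.2 ≤ ((q.1 : ℝ) + q.2) ^ 3 := by
      have : 0 ≤ (q.1 : ℝ) ^ 3 + 2 * q.1 ^ 2 * q.2 + 3 * q.1 * q.2 ^ 2 + q.2 ^ 3 := by positivity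
      nlinarith
    apply one_div_le_one_div_of_le (by positivity)
    calc (q.1 : ℝ) ^ 2 * (q.2 : ℝ) ^ 2 = ((q.1 : ℝ) ^ 2 * q.2) * q.2 ^ 1 := by ring
      _ ≤ _ := by gcongr; linarith

/-- Harmonic numbers. -/
noncomputable def harm (d : ℕ) : ℝ := ∑ m ∈ Finset.range d, 1 / ((m : ℝ) + 1)

lemma telescope_one (d : ℕ) :
    HasSum (fun y : ℕ+ => 1 / ((y : ℝ) + d) - 1 / ((y : ℝ) + (d + 1))) (1 / ((d : ℝ) + 1)) := by
  rw [← Equiv.pnatEquivNat.symm.hasSum_iff]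
  have hh : ((fun y : ℕ+ => 1 / ((y : ℝ) + d) - 1 / ((y : ℝ) + (d + 1)))
      ∘ Equiv.pnatEquivNat.symm)
      = fun n : ℕ => (fun n : ℕ => 1 / ((n : ℝ) + 1 + d)) n
          - (fun n : ℕ => 1 / ((n : ℝ) + 1 + d)) (n + 1) := by
    funext n
    simp
    ring
  rw [hh, hasSum_iff_tendsto_nat_of_nonneg]
  · simp_rw [Finset.sum_range_sub']
    have h0 : Filter.Tendsto (fun n : ℕ => 1 / ((n : ℝ) + 1 + d)) Filter.atTop (nhds 0) := by
      have := (tendsto_one_div_add_atTop_nhds_zero_nat (𝕜 := ℝ)).comp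
        (Filter.tendsto_add_atTop_nat d)
      refine this.congr fun n => ?_
      simp
      ring
    have := (tendsto_const_nhds (x := 1 / (((0 : ℕ) : ℝ) + 1 + d))).sub h0
    convert this using 2
    simp
    ring
  · intro n
    have : (0 : ℝ) < (n : ℝ) + 1 + d := by positivity
    simp only [sub_nonneg]
    apply one_div_le_one_div_of_le this
    push_cast
    linarith

lemma telescope (d : ℕ) :
    HasSum (fun y : ℕ+ => 1 / (y : ℝ) - 1 / ((y : ℝ) + d)) (harm d) := by
  induction d with
  | zero => simp [harm]
  | succ d ih =>
    have := ih.add (telescope_one d)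
    unfold harm at *
    rw [Finset.sum_range_succ]
    convert this using 2
    push_cast
    ring

/-- Pairs fibred over the larger one. -/
noncomputable def sigEquiv :
    (Σ x : ℕ+, Fin ((x : ℕ) - 1)) ≃ {p : ℕ × ℕ // p.2 < p.1 ∧ 0 < p.2} :=
  Equiv.ofBijective
    (fun q => ⟨((q.1 : ℕ), (q.2 : ℕ) + 1), by have := q.2.2; simp only; omega, Nat.succ_pos _⟩)
    (by
      constructor
      · rintro ⟨x, m⟩ ⟨x', m'⟩ h
        simp only [Subtype.mk.injEq, Prod.mk.injEq, PNat.coe_inj, add_left_inj] at h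
        obtain ⟨rfl, h⟩ := h
        rw [Fin.ext h]
      · rintro ⟨⟨x, y⟩, h1, h2⟩
        simp only at h1 h2
        refine ⟨⟨⟨x, by omega⟩, ⟨y - 1, by simp only [PNat.mk_coe]; omega⟩⟩, ?_⟩
        ext <;> simp
        omega)

lemma zeta2_harm (k : ℕ) (hk : 3 ≤ k) :
    HasSum (fun x : ℕ+ => 1 / (x : ℝ) ^ k * harm ((x : ℕ) - 1)) (zeta2 k 1) := by
  have h1 := zeta2_hasSum_one k hk
  have h2 : HasSum (fun p : {p : ℕ × ℕ // p.2 < p.1 ∧ 0 < p.2} =>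
      1 / ((p.val.1 : ℝ) ^ k * (p.val.2 : ℝ) ^ 1)) (zeta2 k 1) := by
    rw [← pairEquiv.hasSum_iff]
    convert h1 using 2
    simp [pairEquiv]
  rw [← sigEquiv.hasSum_iff] at h2
  refine h2.sigma fun x => ?_
  have h3 := hasSum_fintype (fun c : Fin ((x : ℕ) - 1) => 1 / (x : ℝ) ^ k * (1 / ((c : ℝ) + 1)))
  rw [← Finset.mul_sum,
    Fin.sum_univ_eq_sum_range (fun c : ℕ => 1 / ((c : ℝ) + 1)) ((x : ℕ) - 1)] at h3
  have h4 : (fun c : Fin ((x : ℕ) - 1) =>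
      ((fun p : {p : ℕ × ℕ // p.2 < p.1 ∧ 0 < p.2} =>
        1 / ((p.val.1 : ℝ) ^ k * (p.val.2 : ℝ) ^ 1)) ∘ sigEquiv) ⟨x, c⟩)
      = fun c : Fin ((x : ℕ) - 1) => 1 / (x : ℝ) ^ k * (1 / ((c : ℝ) + 1)) := by
    funext c
    change 1 / (((x : ℕ) : ℝ) ^ k * (((c : ℕ) + 1 : ℕ) : ℝ) ^ 1) = _
    rw [pow_one, one_div_mul_one_div]
    push_cast
    rfl
  rw [h4]
  exact h3

lemma harm_total (k : ℕ) (hk : 3 ≤ k) :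
    HasSum (fun x : ℕ+ => 1 / (x : ℝ) ^ k * harm x) (zeta1 (k + 1) + zeta2 k 1) := by
  have := (zeta1_summable (k + 1) (by omega)).hasSum.add (zeta2_harm k hk)
  unfold zeta1
  convert this using 2 with x
  obtain ⟨n, hn⟩ : ∃ n : ℕ, (x : ℕ) = n + 1 := ⟨x - 1, by have := x.pos; omega⟩
  have hx : (x : ℝ) = n + 1 := by exact_mod_cast hn
  rw [hx, hn, Nat.add_sub_cancel, harm, Finset.sum_range_succ, ← harm]
  have : (n : ℝ) + 1 ≠ 0 := by positivity
  field_simp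
  ring

lemma sum_reflect_Icc (B : ℕ) (f : ℕ → ℝ) :
    ∑ n ∈ Finset.Icc 2 (B + 1), f n = ∑ j ∈ Finset.range B, f (B + 1 - j) := by
  refine Finset.sum_nbij' (fun n => B + 1 - n) (fun j => B + 1 - j) ?_ ?_ ?_ ?_ ?_
  · intro n hn; simp at hn ⊢; omega
  · intro n hn; simp at hn ⊢; omega
  · intro n hn; simp at hn ⊢; omega
  · intro n hn; simp at hn ⊢; omega
  · intro n hn; simp at hn; congr 1; omega

lemma pfW_eq (a b : ℕ) (t v : ℝ) :
    pfW a b t v = (∑ n ∈ Finset.Icc 2 (b + 1), ((a + b + 1 - n).choose a : ℝ)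
      * t ^ (a + b + 2 - n) * v ^ n) + ((a + b).choose a : ℝ) * t ^ (a + b + 1) * v := by
  unfold pfW
  rw [Finset.sum_range_succ, sum_reflect_Icc]
  congr 1
  · refine Finset.sum_congr rfl fun j hj => ?_
    simp at hj
    rw [show a + b + 1 - (b + 1 - j) = a + j by omega,
      show a + b + 2 - (b + 1 - j) = a + 1 + j by omega]
  · rw [show a + 1 + b = a + b + 1 by ring, show b + 1 - b = 1 by omega, pow_one]

theorem decomposition_length_two (a b : ℕ) (ha : 2 ≤ a) (hb : 2 ≤ b) :
    zeta2 a b = (-1 : ℝ) ^ b *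
      ((∑ n ∈ Finset.Icc 2 b, (-1 : ℝ) ^ n * (Nat.choose (a + b - n - 1) (a - 1) : ℝ)
          * zeta1 n * zeta1 (a + b - n))
        + (∑ n ∈ Finset.Icc 2 a, (Nat.choose (a + b - n - 1) (b - 1) : ℝ)
            * zeta2 n (a + b - n))
        - (Nat.choose (a + b - 2) (a - 1) : ℝ)
            * (zeta1 (a + b) + zeta2 (a + b - 1) 1)) := by
  -- the three families of sums
  have H1 := hasSum_sum (s := Finset.Icc 2 b) (fun n hn =>
    (prod_hasSum n (a + b - n) (by simp at hn; omega) (by simp at hn; omega)).mul_left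
      ((-1 : ℝ) ^ n * (Nat.choose (a + b - n - 1) (a - 1) : ℝ)))
  have H2 := hasSum_sum (s := Finset.Icc 2 a) (fun n hn =>
    (zeta2_hasSum n (a + b - n) (by simp at hn; omega) (by simp at hn; omega)).mul_left
      (Nat.choose (a + b - n - 1) (b - 1) : ℝ))
  have H0 : HasSum (fun q : ℕ+ × ℕ+ => 1 / (((q.1 : ℝ) + q.2) ^ a * (q.1 : ℝ) ^ b))
      (zeta2 a b) := by
    have := zeta2_hasSum a b ha hb
    rw [← (Equiv.prodComm ℕ+ ℕ+).hasSum_iff] at this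
    convert this using 2 with q
    simp [add_comm]
  set C : ℝ := (Nat.choose (a + b - 2) (a - 1) : ℝ) with hC
  have hCpos : C ≠ 0 := by
    have : 0 < Nat.choose (a + b - 2) (a - 1) := Nat.choose_pos (by omega)
    rw [hC]; positivity
  -- the pointwise identity
  have key : ∀ q : ℕ+ × ℕ+,
      C * (1 / (q.2 : ℝ) ^ (a + b - 1) * (1 / (q.1 : ℝ) - 1 / ((q.1 : ℝ) + q.2)))
      = (∑ n ∈ Finset.Icc 2 b, (-1 : ℝ) ^ n * (Nat.choose (a + b - n - 1) (a - 1) : ℝ)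
          * (1 / (q.1 : ℝ) ^ n * (1 / (q.2 : ℝ) ^ (a + b - n))))
        + (∑ n ∈ Finset.Icc 2 a, (Nat.choose (a + b - n - 1) (b - 1) : ℝ)
          * (1 / (((q.1 : ℝ) + q.2) ^ n * (q.2 : ℝ) ^ (a + b - n))))
        - (-1 : ℝ) ^ b * (1 / (((q.1 : ℝ) + q.2) ^ a * (q.1 : ℝ) ^ b)) := by
    intro q
    have h1 := pnat_cast_pos q.1
    have h2 := pnat_cast_pos q.2
    generalize (q.1 : ℝ) = y at *
    generalize (q.2 : ℝ) = d at *
    have h3 : 0 < y + d := by positivity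
    obtain ⟨A, rfl⟩ : ∃ A, a = A + 1 := ⟨a - 1, by omega⟩
    obtain ⟨B, rfl⟩ : ∃ B, b = B + 1 := ⟨b - 1, by omega⟩
    have P := pf_identity (1 / d) (1 / y) (1 / (y + d)) (by field_simp; ring) A B
    rw [pfW_eq, pfW_eq] at P
    have e1 : (-1 : ℝ) ^ (A + 1) * ∑ n ∈ Finset.Icc 2 (B + 1), ((A + B + 1 - n).choose A : ℝ)
        * (-(1 / d)) ^ (A + B + 2 - n) * (1 / y) ^ n
        = (-1 : ℝ) ^ (B + 1) * ∑ n ∈ Finset.Icc 2 (B + 1), (-1 : ℝ) ^ n *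
          (Nat.choose (A + 1 + (B + 1) - n - 1) (A + 1 - 1) : ℝ)
          * (1 / y ^ n * (1 / d ^ (A + 1 + (B + 1) - n))) := by
      rw [Finset.mul_sum, Finset.mul_sum]
      refine Finset.sum_congr rfl fun n hn => ?_
      simp only [Finset.mem_Icc] at hn
      obtain ⟨j, hj⟩ : ∃ j, B + 1 = n + j := ⟨B + 1 - n, by omega⟩
      rw [show A + B + 1 - n = A + j by omega, show A + B + 2 - n = A + 1 + j by omega,
        show A + 1 + (B + 1) - n - 1 = A + j by omega,
        show A + 1 + (B + 1) - n = A + 1 + j by omega, hj, Nat.add_sub_cancel,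
        neg_pow (1 / d), one_div_pow, one_div_pow, pow_add (-1 : ℝ) (A + 1) j, pow_add (-1 : ℝ) n j]
      have s1 : (-1 : ℝ) ^ (A + 1) * (-1) ^ (A + 1) = 1 := by rw [← mul_pow]; simp
      have s2 : (-1 : ℝ) ^ n * (-1) ^ n = 1 := by rw [← mul_pow]; simp
      linear_combination (((A + j).choose A : ℝ) * (-1) ^ j * (1 / d ^ (A + 1 + j)) * (1 / y ^ n))
        * (s1 - s2)
    have e2 : ∑ n ∈ Finset.Icc 2 (A + 1), ((B + A + 1 - n).choose B : ℝ)
        * (1 / d) ^ (B + A + 2 - n) * (1 / (y + d)) ^ n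
        = ∑ n ∈ Finset.Icc 2 (A + 1), (Nat.choose (A + 1 + (B + 1) - n - 1) (B + 1 - 1) : ℝ)
          * (1 / ((y + d) ^ n * d ^ (A + 1 + (B + 1) - n))) := by
      refine Finset.sum_congr rfl fun n hn => ?_
      rw [show B + A + 1 - n = A + 1 + (B + 1) - n - 1 by omega,
        show B + A + 2 - n = A + 1 + (B + 1) - n by omega, Nat.add_sub_cancel,
        one_div_pow, one_div_pow, ← one_div_mul_one_div]
      ring
    have e3 : ((B + A).choose B : ℝ) = C := by
      rw [hC, show A + 1 + (B + 1) - 2 = A + B by omega, Nat.add_sub_cancel, add_comm B A,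
        Nat.choose_symm_add]
    have e4 : ((A + B).choose A : ℝ) = C := by
      rw [hC, show A + 1 + (B + 1) - 2 = A + B by omega, Nat.add_sub_cancel]
    rw [mul_add, mul_add, e1, e2, e3, e4] at P
    rw [show A + 1 + (B + 1) - 1 = A + B + 1 by omega]
    rw [show B + A + 1 = A + B + 1 by ring, neg_pow (1 / d), one_div_pow, one_div_pow,
      one_div_pow] at P
    rw [← one_div_mul_one_div]
    have s3 : (-1 : ℝ) ^ (B + 1) * (-1) ^ (B + 1) = 1 := by rw [← mul_pow]; simp
    have s4 : (-1 : ℝ) ^ (A + 1) * (-1) ^ (A + B + 1) = - (-1) ^ (B + 1) := by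
      have : (-1 : ℝ) ^ A * (-1) ^ A = 1 := by rw [← mul_pow]; simp
      rw [pow_add, pow_add, pow_add, pow_add]
      linear_combination (-1 : ℝ) ^ B * this
    generalize (∑ n ∈ Finset.Icc 2 (B + 1), (-1 : ℝ) ^ n *
          (Nat.choose (A + 1 + (B + 1) - n - 1) (A + 1 - 1) : ℝ)
          * (1 / y ^ n * (1 / d ^ (A + 1 + (B + 1) - n)))) = X at *
    generalize (∑ n ∈ Finset.Icc 2 (A + 1),
          (Nat.choose (A + 1 + (B + 1) - n - 1) (B + 1 - 1) : ℝ)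
          * (1 / ((y + d) ^ n * d ^ (A + 1 + (B + 1) - n)))) = Y at *
    generalize 1 / d ^ (A + B + 1) = D at *
    generalize (-1 : ℝ) ^ (B + 1) = s at *
    linear_combination s * P + (X + Y - C * D * (1 / y) + C * D * (1 / (y + d))) * s3
      + s * C * D * (1 / y) * s4
  have H3 := (H1.add H2).sub (H0.mul_left ((-1 : ℝ) ^ b))
  simp_rw [← key] at H3
  -- evaluate the remaining sum along fibres
  have HR := H3.mul_left C⁻¹
  simp_rw [inv_mul_cancel_left₀ hCpos] at HR
  rw [← (Equiv.prodComm ℕ+ ℕ+).hasSum_iff] at HR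
  have HF := HR.prod_fiberwise (fun d => (telescope d).mul_left (1 / (d : ℝ) ^ (a + b - 1)))
  have HE := HF.unique (harm_total (a + b - 1) (by omega))
  rw [show a + b - 1 + 1 = a + b by omega, inv_mul_eq_iff_eq_mul₀ hCpos] at HE
  rw [← HE]
  have s3 : (-1 : ℝ) ^ b * (-1) ^ b = 1 := by rw [← mul_pow]; simp
  simp only [mul_assoc] at *
  linear_combination (-zeta2 a b) * s3
end

section
/- For any integers k₁,…,k_{m−1} ≥ 1 with the sequence admissible (k₁ ≥ 2), the sum rule holds: ζ(k₁,…,k_{m−1})·ζ(1) − ζ(1,k₁,…,k_{m−1}) (interpreted as the convergent combination) equals Σ_{κ=1}^{m−1} [ ζ(k₁,…,k_{κ−1}, k_κ+1, k_{κ+1},…,k_{m−1}) + ζ(k₁,…,k_κ, 1, k_{κ+1},…,k_{m−1}) ]. Precisely: lim_{N→∞} [ (Σ_{n=1}^N 1/n)·ζ(k₁,…,k_{m−1}) − Σ_{n₀ ≤ N, n₀>n₁>…>n_{m−1}>0} 1/(n₀ n₁^{k₁}⋯n_{m−1}^{k_{m−1}}) ] equals the stated right-hand side. -/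
/-- The multiple zeta value `ζ(k₁,…,k_r)` for an index list `k`,
as a sum over strictly decreasing tuples of positive integers. -/
noncomputable def mzv (k : List ℕ) : ℝ :=
  ∑' f : {f : Fin k.length → ℕ // StrictAnti f ∧ ∀ i, 0 < f i},
    ∏ i, 1 / (f.val i : ℝ) ^ (k.get i)

/-- The truncated divergent series `Σ_{N ≥ n₀ > n₁ > … > n_{m-1} > 0}
`1/(n₀ n₁^{k₁} ⋯ n_{m-1}^{k_{m-1}})`. -/
noncomputable def mzvOneTrunc (k : List ℕ) (N : ℕ) : ℝ :=
  ∑' f : {f : Fin (1 :: k).length → ℕ // StrictAnti f ∧ (∀ i, 0 < f i) ∧ f ⟨0, by simp⟩ ≤ N},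
    ∏ i, 1 / (f.val i : ℝ) ^ ((1 :: k).get i)

/-- Truncated multiple harmonic sums, defined recursively. -/
noncomputable def ZZ : List ℕ → ℕ → ℝ
  | [], _ => 1
  | a :: k, N => ∑ n ∈ Finset.range N, 1 / ((n : ℝ) + 1) ^ a * ZZ k n

lemma ZZ_succ (a : ℕ) (k : List ℕ) (N : ℕ) :
    ZZ (a :: k) (N + 1) = ZZ (a :: k) N + 1 / ((N : ℝ) + 1) ^ a * ZZ k N := by
  simp [ZZ, Finset.sum_range_succ]

lemma ZZ_nonneg (k : List ℕ) : ∀ N, 0 ≤ ZZ k N := by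
  induction k with
  | nil => intro N; simp [ZZ]
  | cons a k ih =>
    intro N
    exact Finset.sum_nonneg fun n _ => mul_nonneg (by positivity) (ih n)

lemma ZZ_one_mono : Monotone (ZZ [1]) := by
  apply monotone_nat_of_le_succ
  intro n
  rw [ZZ_succ]
  have : 0 ≤ 1 / ((n : ℝ) + 1) ^ 1 * ZZ [] n := mul_nonneg (by positivity) (ZZ_nonneg _ _)
  linarith

lemma ZZ_le (k : List ℕ) (hk : ∀ x ∈ k, 1 ≤ x) : ∀ N, ZZ k N ≤ ZZ [1] N ^ k.length := by
  induction k with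
  | nil => intro N; simp [ZZ]
  | cons a k ih =>
    intro N
    have ih' := ih (fun x hx => hk x (by simp [hx]))
    have ha : 1 ≤ a := hk a (by simp)
    calc ZZ (a :: k) N = ∑ n ∈ Finset.range N, 1 / ((n : ℝ) + 1) ^ a * ZZ k n := rfl
      _ ≤ ∑ n ∈ Finset.range N, 1 / ((n : ℝ) + 1) ^ 1 * ZZ [1] N ^ k.length := by
        apply Finset.sum_le_sum
        intro n hn
        apply mul_le_mul _ _ (ZZ_nonneg _ _) (by positivity)
        · apply one_div_le_one_div_of_le (by positivity)
          exact pow_le_pow_right₀ (by linarith [(Nat.cast_nonneg n : (0:ℝ) ≤ n)]) ha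
        · refine (ih' n).trans ?_
          exact pow_le_pow_left₀ (ZZ_nonneg _ _)
            (ZZ_one_mono (Finset.mem_range.1 hn).le) _
      _ = ZZ [1] N ^ (a :: k).length := by
        rw [← Finset.sum_mul, List.length_cons, pow_succ']
        simp [ZZ]

/-- finite stuffle -/
lemma stuffle (k : List ℕ) : ∀ N, ZZ [1] N * ZZ k N = ZZ (1 :: k) N +
    ∑ κ : Fin k.length, (ZZ (k.take κ ++ (k.get κ + 1) :: k.drop (κ + 1)) N
          + ZZ (k.take (κ + 1) ++ 1 :: k.drop (κ + 1)) N) := by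
  induction k with
  | nil => intro N; simp [ZZ]
  | cons a k ih =>
    have e : ∀ M, (∑ κ : Fin (a :: k).length,
        (ZZ ((a :: k).take κ ++ ((a :: k).get κ + 1) :: (a :: k).drop (κ + 1)) M
        + ZZ ((a :: k).take (κ + 1) ++ 1 :: (a :: k).drop (κ + 1)) M))
        = ZZ ((a + 1) :: k) M + ZZ (a :: 1 :: k) M + ∑ κ : Fin k.length,
        (ZZ (a :: (k.take κ ++ (k.get κ + 1) :: k.drop (κ + 1))) M
        + ZZ (a :: (k.take (κ + 1) ++ 1 :: k.drop (κ + 1))) M) := by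
      intro M
      erw [Fin.sum_univ_succ]
      simp
    intro N
    induction N with
    | zero => rw [e]; simp [ZZ]
    | succ N ihN =>
      rw [e] at ihN ⊢
      have ihk := ih N
      simp only [ZZ_succ] at ihN ⊢
      have e2 : (∑ κ : Fin k.length,
          (ZZ (a :: (k.take κ ++ (k.get κ + 1) :: k.drop (κ + 1))) N
            + 1 / ((N : ℝ) + 1) ^ a * ZZ (k.take κ ++ (k.get κ + 1) :: k.drop (κ + 1)) N
          + (ZZ (a :: (k.take (κ + 1) ++ 1 :: k.drop (κ + 1))) N
            + 1 / ((N : ℝ) + 1) ^ a * ZZ (k.take (κ + 1) ++ 1 :: k.drop (κ + 1)) N)))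
          = (∑ κ : Fin k.length,
          (ZZ (a :: (k.take κ ++ (k.get κ + 1) :: k.drop (κ + 1))) N
          + ZZ (a :: (k.take (κ + 1) ++ 1 :: k.drop (κ + 1))) N))
          + 1 / ((N : ℝ) + 1) ^ a * ∑ κ : Fin k.length,
          (ZZ (k.take κ ++ (k.get κ + 1) :: k.drop (κ + 1)) N
          + ZZ (k.take (κ + 1) ++ 1 :: k.drop (κ + 1)) N) := by
        rw [Finset.mul_sum, ← Finset.sum_add_distrib]
        exact Finset.sum_congr rfl fun _ _ => by ring
      rw [e2]
      have h0 : ZZ [] N = 1 := rfl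
      have hp : 1 / ((N : ℝ) + 1) ^ (a + 1) = 1 / ((N : ℝ) + 1) ^ a * (1 / ((N : ℝ) + 1) ^ 1) := by
        rw [pow_succ]; simp [mul_comm]
      rw [h0, hp]
      linear_combination ihN + 1 / ((N : ℝ) + 1) ^ a * ihk

lemma ZZ_one_le (n : ℕ) : ZZ [1] n ≤ 1 + Real.log n := by
  have := harmonic_le_one_add_log n
  convert this using 1
  simp [ZZ, harmonic]

open Asymptotics Filter in
lemma summable_pow (r : ℕ) : Summable fun n : ℕ => 1 / ((n : ℝ) + 1) ^ 2 * ZZ [1] n ^ r := by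
  have h1 : (fun x : ℝ => (1 + Real.log x)) =O[atTop] Real.log := by
    refine IsBigO.add ?_ (isBigO_refl _ _)
    exact (Real.isLittleO_const_log_atTop).isBigO
  have h2 : (fun x : ℝ => (1 + Real.log x) ^ r) =O[atTop] fun x => x ^ (1/2 : ℝ) := by
    refine (h1.pow r).trans ?_
    have := (isLittleO_log_rpow_rpow_atTop (r : ℝ) (s := 1/2) (by norm_num)).isBigO
    simpa using this
  have h3 : (fun n : ℕ => ZZ [1] n ^ r) =O[atTop] fun n : ℕ => (n : ℝ) ^ (1/2 : ℝ) := by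
    refine IsBigO.trans ?_ (h2.comp_tendsto tendsto_natCast_atTop_atTop)
    refine IsBigO.of_bound 1 (Eventually.of_forall fun n => ?_)
    have h := ZZ_one_le n
    have h' := ZZ_nonneg [1] n
    simp only [Function.comp, one_mul, Real.norm_eq_abs]
    rw [abs_of_nonneg (pow_nonneg h' _), abs_of_nonneg (pow_nonneg (h'.trans h) _)]
    exact pow_le_pow_left₀ h' h _
  have h4 : (fun n : ℕ => 1 / ((n : ℝ) + 1) ^ 2) =O[atTop] fun n : ℕ => (n : ℝ) ^ (-2 : ℝ) := by
    refine IsBigO.of_bound 1 ((eventually_gt_atTop 0).mono fun n hn => ?_)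
    have hn' : (0 : ℝ) < n := by exact_mod_cast hn
    rw [Real.rpow_neg hn'.le, one_mul, Real.norm_of_nonneg (by positivity),
      Real.norm_of_nonneg (by positivity), ← one_div]
    norm_cast
    apply one_div_le_one_div_of_le (by positivity)
    push_cast
    gcongr
    simp
  have h5 := h4.mul h3
  refine summable_of_isBigO_nat (g := fun n : ℕ => (n : ℝ) ^ (-3/2 : ℝ))
    (Real.summable_nat_rpow.2 (by norm_num)) (h5.trans ?_)
  refine IsBigO.of_bound 1 ((eventually_gt_atTop 0).mono fun n hn => ?_)
  have hn' : (0 : ℝ) < n := by exact_mod_cast hn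
  rw [← Real.rpow_add hn', one_mul]
  norm_num

lemma summable_H (a r : ℕ) (k : List ℕ) (ha : 2 ≤ a) (hk : ∀ x ∈ k, 1 ≤ x) :
    Summable fun n : ℕ => ZZ [1] n ^ r * (1 / ((n : ℝ) + 1) ^ a * ZZ k n) := by
  refine Summable.of_nonneg_of_le (fun n => ?_) (fun n => ?_) (summable_pow (r + k.length))
  · exact mul_nonneg (pow_nonneg (ZZ_nonneg _ _) _)
      (mul_nonneg (by positivity) (ZZ_nonneg _ _))
  · have h1 : 1 / ((n : ℝ) + 1) ^ a ≤ 1 / ((n : ℝ) + 1) ^ 2 := by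
      apply one_div_le_one_div_of_le (by positivity)
      exact pow_le_pow_right₀ (by linarith [(Nat.cast_nonneg n : (0:ℝ) ≤ n)]) ha
    have h2 := ZZ_le k hk n
    have h3 : 1 / ((n : ℝ) + 1) ^ a * ZZ k n ≤ 1 / ((n : ℝ) + 1) ^ 2 * ZZ [1] n ^ k.length :=
      mul_le_mul h1 h2 (ZZ_nonneg _ _) (by positivity)
    calc _ ≤ _ := mul_le_mul_of_nonneg_left h3 (pow_nonneg (ZZ_nonneg _ _) r)
      _ = _ := by rw [pow_add]; ring

open Classical in
/-- bounded strictly decreasing tuples -/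
noncomputable def SS (r N : ℕ) : Finset (Fin r → ℕ) :=
  (Fintype.piFinset fun _ => Finset.range (N + 1)).filter
    (fun f => StrictAnti f ∧ ∀ i, 0 < f i)

lemma mem_SS {r N : ℕ} {f : Fin r → ℕ} :
    f ∈ SS r N ↔ (∀ i, f i ≤ N) ∧ StrictAnti f ∧ ∀ i, 0 < f i := by
  simp [SS, Nat.lt_succ_iff]

lemma strictAnti_cons {r n : ℕ} {g : Fin r → ℕ} :
    StrictAnti (Fin.cons n g : Fin (r + 1) → ℕ) ↔ (∀ i, g i < n) ∧ StrictAnti g := by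
  constructor
  · intro h
    refine ⟨fun i => ?_, fun i j hij => ?_⟩
    · simpa using h (Fin.succ_pos i)
    · simpa using h (Fin.succ_lt_succ_iff.2 hij)
  · rintro ⟨h1, h2⟩ i j hij
    induction j using Fin.cases with
    | zero => simp at hij
    | succ j =>
      induction i using Fin.cases with
      | zero => simpa using h1 j
      | succ i => simpa using h2 (Fin.succ_lt_succ_iff.1 hij)

lemma sum_SS_succ (r N : ℕ) (F : (Fin (r + 1) → ℕ) → ℝ) :
    ∑ f ∈ SS (r + 1) N, F f
      = ∑ n ∈ Finset.range N, ∑ g ∈ SS r n, F (Fin.cons (n + 1) g) := by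
  rw [Finset.sum_sigma']
  symm
  refine Finset.sum_bij' (fun p _ => (Fin.cons (p.1 + 1) p.2 : Fin (r + 1) → ℕ))
    (fun f _ => ⟨f 0 - 1, Fin.tail f⟩) ?_ ?_ ?_ ?_ ?_
  · rintro ⟨n, g⟩ h
    simp only [Finset.mem_sigma, Finset.mem_range, mem_SS] at h
    obtain ⟨hn, h1, h2, h3⟩ := h
    rw [mem_SS, strictAnti_cons]
    refine ⟨?_, ⟨fun i => Nat.lt_succ_of_le (h1 i), h2⟩, ?_⟩
    · intro i
      induction i using Fin.cases with
      | zero => simpa using hn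
      | succ i => simpa using (h1 i).trans hn.le
    · intro i
      induction i using Fin.cases with
      | zero => simp
      | succ i => simpa using h3 i
  · intro f h
    rw [mem_SS] at h
    obtain ⟨h1, h2, h3⟩ := h
    simp only [Finset.mem_sigma, Finset.mem_range, mem_SS]
    have a := h1 0
    have b := h3 0
    refine ⟨by omega, fun i => ?_, fun i j hij => h2 (Fin.succ_lt_succ_iff.2 hij),
      fun i => h3 _⟩
    have := h2 (Fin.succ_pos i)
    simp only [Fin.tail]
    omega
  · rintro ⟨n, g⟩ h
    simp
  · intro f h
    rw [mem_SS] at h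
    have b := h.2.2 0
    have : f 0 - 1 + 1 = f 0 := by omega
    simp [this]
  · rintro ⟨n, g⟩ h
    rfl

lemma sum_SS (k : List ℕ) : ∀ N, ∑ f ∈ SS k.length N, ∏ i, 1 / (f i : ℝ) ^ (k.get i) = ZZ k N := by
  induction k with
  | nil =>
    intro N
    have : SS ([] : List ℕ).length N = {Fin.elim0} := by
      ext f
      rw [mem_SS]
      simp only [Finset.mem_singleton]
      refine ⟨fun _ => funext fun i => i.elim0, fun _ => ⟨fun i => i.elim0, fun i => i.elim0, fun i => i.elim0⟩⟩
    rw [this]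
    simp [ZZ]
  | cons a k ih =>
    intro N
    refine (sum_SS_succ k.length N _).trans ?_
    simp only [ZZ]
    refine Finset.sum_congr rfl fun n _ => ?_
    rw [← ih n, Finset.mul_sum]
    refine Finset.sum_congr rfl fun g _ => ?_
    refine (Fin.prod_univ_succ _).trans ?_
    simp

lemma oneTrunc_eq (k : List ℕ) (N : ℕ) : mzvOneTrunc k N = ZZ (1 :: k) N := by
  rw [← sum_SS]
  unfold mzvOneTrunc
  have hs : {f : Fin (1 :: k).length → ℕ | StrictAnti f ∧ (∀ i, 0 < f i) ∧ f ⟨0, by simp⟩ ≤ N}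
      = ↑(SS (1 :: k).length N) := by
    ext f
    simp only [Set.mem_setOf_eq, Finset.mem_coe, mem_SS]
    constructor
    · rintro ⟨h1, h2, h3⟩
      exact ⟨fun i => (h1.antitone (Fin.mk_le_of_le_val (Nat.zero_le _))).trans h3, h1, h2⟩
    · rintro ⟨h1, h2, h3⟩
      exact ⟨h2, h3, h1 _⟩
  rw [← Finset.tsum_subtype' (SS (1 :: k).length N)
    (fun f => ∏ i, 1 / (f i : ℝ) ^ ((1 :: k).get i)), ← hs]
  rfl

open Filter in
lemma tendsto_mzv (a : ℕ) (k : List ℕ) (ha : 2 ≤ a) (hk : ∀ x ∈ k, 1 ≤ x) :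
    Tendsto (ZZ (a :: k)) atTop (nhds (mzv (a :: k))) := by
  classical
  have hsum := summable_H a 0 k ha hk
  simp only [pow_zero, one_mul] at hsum
  set K := a :: k with hK
  set A : Set (Fin K.length → ℕ) := {f | StrictAnti f ∧ ∀ i, 0 < f i} with hA
  set F : (Fin K.length → ℕ) → ℝ := fun f => ∏ i, 1 / (f i : ℝ) ^ (K.get i) with hF
  have e1 : mzv K = ∑' f, A.indicator F f := by
    rw [← tsum_subtype]; rfl
  let P : ℕ → Finset (Fin K.length → ℕ) := fun N => Fintype.piFinset fun _ => Finset.range (N + 1)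
  have e2 : ∀ N, ∑ f ∈ P N, A.indicator F f = ZZ K N := by
    intro N
    rw [← sum_SS, SS, Finset.sum_filter]
    refine Finset.sum_congr rfl fun f _ => ?_
    simp only [Set.indicator, hA, Set.mem_setOf_eq, hF]
  have hPm : Monotone P := by
    intro M N h
    apply Fintype.piFinset_subset
    intro i
    exact Finset.range_mono (by omega)
  have hPt : Tendsto P atTop atTop := by
    apply tendsto_atTop_finset_of_monotone hPm
    intro f
    refine ⟨∑ i, f i, ?_⟩
    simp only [P, Fintype.mem_piFinset, Finset.mem_range]
    intro i
    exact Nat.lt_succ_of_le (Finset.single_le_sum (fun _ _ => Nat.zero_le _) (Finset.mem_univ i))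
  have hnn : ∀ f, 0 ≤ A.indicator F f := fun f =>
    Set.indicator_nonneg (fun f _ => Finset.prod_nonneg fun i _ => by positivity) f
  have hb : ∀ N, ZZ K N ≤ ∑' n : ℕ, 1 / ((n : ℝ) + 1) ^ a * ZZ k n := fun N =>
    hsum.sum_le_tsum _ (fun n _ => mul_nonneg (by positivity) (ZZ_nonneg _ _))
  have hS : Summable (A.indicator F) := by
    refine summable_of_sum_le hnn (c := ∑' n : ℕ, 1 / ((n : ℝ) + 1) ^ a * ZZ k n) fun u => ?_
    obtain ⟨N, hN⟩ := (hPt.eventually (eventually_ge_atTop u)).exists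
    refine (Finset.sum_le_sum_of_subset_of_nonneg hN fun f _ _ => hnn f).trans ?_
    rw [e2]; exact hb N
  rw [e1]
  have := hS.hasSum.comp hPt
  refine this.congr fun N => e2 N

open Filter in
lemma tail_zero (a : ℕ) (k : List ℕ) (ha : 2 ≤ a) (hk : ∀ x ∈ k, 1 ≤ x) :
    Tendsto (fun N => ZZ [1] N * (mzv (a :: k) - ZZ (a :: k) N)) atTop (nhds 0) := by
  have hs := summable_H a 0 k ha hk
  have hs1 := summable_H a 1 k ha hk
  simp only [pow_zero, one_mul] at hs
  simp only [pow_one] at hs1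
  have e : mzv (a :: k) = ∑' n : ℕ, 1 / ((n : ℝ) + 1) ^ a * ZZ k n :=
    tendsto_nhds_unique (tendsto_mzv a k ha hk) hs.hasSum.tendsto_sum_nat
  have hnn : ∀ n : ℕ, 0 ≤ 1 / ((n : ℝ) + 1) ^ a * ZZ k n :=
    fun n => mul_nonneg (by positivity) (ZZ_nonneg _ _)
  have e2 : ∀ N, mzv (a :: k) - ZZ (a :: k) N
      = ∑' n : ℕ, 1 / (((n + N : ℕ) : ℝ) + 1) ^ a * ZZ k (n + N) := by
    intro N
    rw [e, ← hs.sum_add_tsum_nat_add N]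
    simp [ZZ]
  refine squeeze_zero (fun N => ?_) (fun N => ?_)
    (tendsto_sum_nat_add fun n : ℕ => ZZ [1] n * (1 / ((n : ℝ) + 1) ^ a * ZZ k n))
  · rw [e2]
    exact mul_nonneg (ZZ_nonneg _ _) (tsum_nonneg fun n => hnn _)
  · rw [e2, ← tsum_mul_left]
    refine Summable.tsum_le_tsum (fun n => ?_) (((summable_nat_add_iff N).2 hs).mul_left _)
      ((summable_nat_add_iff N).2 hs1)
    exact mul_le_mul_of_nonneg_right (ZZ_one_mono (Nat.le_add_left _ _)) (hnn _)

theorem sum_rule_limit (k : List ℕ) (hne : k ≠ [])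
    (hadm : 2 ≤ k.headI) (hpos : ∀ i : Fin k.length, 1 ≤ k.get i) :
    Filter.Tendsto
      (fun N : ℕ => (∑ n ∈ Finset.Icc 1 N, (1 : ℝ) / n) * mzv k - mzvOneTrunc k N)
      Filter.atTop
      (nhds (∑ κ : Fin k.length,
        (mzv (k.take κ ++ (k.get κ + 1) :: k.drop (κ + 1))
          + mzv (k.take (κ + 1) ++ 1 :: k.drop (κ + 1))))) := by
  have hk : ∀ x ∈ k, 1 ≤ x := by
    intro x hx
    obtain ⟨i, rfl⟩ := List.get_of_mem hx
    exact hpos i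
  have conv : ∀ l : List ℕ, 2 ≤ l.headI → (∀ x ∈ l, 1 ≤ x) →
      Filter.Tendsto (ZZ l) Filter.atTop (nhds (mzv l)) := by
    intro l h1 h2
    cases l with
    | nil => simp at h1
    | cons b l => exact tendsto_mzv b l h1 fun x hx => h2 x (by simp [hx])
  have hH : ∀ N : ℕ, (∑ n ∈ Finset.Icc 1 N, (1 : ℝ) / n) = ZZ [1] N := by
    intro N
    induction N with
    | zero => simp [ZZ]
    | succ N ih =>
      rw [Finset.sum_Icc_succ_top (by omega), ih, ZZ_succ]
      simp [ZZ]
  have htail : Filter.Tendsto (fun N => ZZ [1] N * (mzv k - ZZ k N)) Filter.atTop (nhds 0) := by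
    cases k with
    | nil => simp at hne
    | cons b l => exact tail_zero b l hadm fun x hx => hk x (by simp [hx])
  have hR : Filter.Tendsto (fun N => ∑ κ : Fin k.length,
        (ZZ (k.take κ ++ (k.get κ + 1) :: k.drop (κ + 1)) N
          + ZZ (k.take (κ + 1) ++ 1 :: k.drop (κ + 1)) N)) Filter.atTop
      (nhds (∑ κ : Fin k.length,
        (mzv (k.take κ ++ (k.get κ + 1) :: k.drop (κ + 1))
          + mzv (k.take (κ + 1) ++ 1 :: k.drop (κ + 1))))) := by
    refine tendsto_finsetSum _ fun κ _ => Filter.Tendsto.add (conv _ ?_ ?_) (conv _ ?_ ?_)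
    · cases k with
      | nil => exact κ.elim0
      | cons b l =>
        induction κ using Fin.cases with
        | zero => simp at hadm ⊢; omega
        | succ κ => simpa using hadm
    · intro x hx
      simp only [List.mem_append, List.mem_cons] at hx
      rcases hx with hx | rfl | hx
      · exact hk x (List.mem_of_mem_take hx)
      · omega
      · exact hk x (List.mem_of_mem_drop hx)
    · cases k with
      | nil => exact κ.elim0
      | cons b l => simpa using hadm
    · intro x hx
      simp only [List.mem_append, List.mem_cons] at hx
      rcases hx with hx | rfl | hx
      · exact hk x (List.mem_of_mem_take hx)
      · omega
      · exact hk x (List.mem_of_mem_drop hx)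
  have := htail.add hR
  rw [zero_add] at this
  refine this.congr fun N => ?_
  rw [hH, oneTrunc_eq]
  have := stuffle k N
  linear_combination -this
end
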